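/- The Toeplitz matrix elements of the triangular-lattice Ising model, viewed as functions of the couplings (K_1,K_2,K_3), satisfy for every n ∈ ℤ the symmetries: w_n(K_1,K_2,K_3) = w_n(−K_1,−K_2,K_3), w_n(K_1,K_2,K_3) = (−1)^{n+1} w_n(−K_1,K_2,−K_3), and w_n(K_1,K_2,K_3) = (−1)^{n+1} w_n(K_1,−K_2,−K_3). -/

import Mathlib

open MeasureTheory

/-- The parameter `a` of the triangular-lattice Ising weight. -/
noncomputable def aT (K1 K2 K3 : ℝ) : ℝ :=
  2*Real.tanh K3*(1+(Real.tanh K1)^2)*(1+(Real.tanh K2)^2)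
    + 4*Real.tanh K1*Real.tanh K2*(1+(Real.tanh K3)^2)

/-- The parameter `c` of the triangular-lattice Ising weight. -/
noncomputable def cT (K1 K2 : ℝ) : ℝ :=
  (1-(Real.tanh K1)^2)*(1-(Real.tanh K2)^2)

/-- The parameter `b = z₃² c` of the triangular-lattice Ising weight. -/
noncomputable def bT (K1 K2 K3 : ℝ) : ℝ :=
  (Real.tanh K3)^2 * cT K1 K2

/-- The radicand `R(θ)` appearing in the triangular-lattice Toeplitz matrix element. -/
noncomputable def RT (K1 K2 K3 θ : ℝ) : ℝ :=
  (aT K1 K2 K3)^2 + (bT K1 K2 K3)^2 + (cT K1 K2)^2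
    - 2*(aT K1 K2 K3)*(bT K1 K2 K3 + cT K1 K2)*Real.cos θ
    + 2*(bT K1 K2 K3)*(cT K1 K2)*Real.cos (2*θ)

/-- The Toeplitz matrix element `w_n(K₁,K₂,K₃)` of the diagonal correlations of the
triangular-lattice Ising model. -/
noncomputable def wT (K1 K2 K3 : ℝ) (n : ℤ) : ℝ :=
  (1/(2*Real.pi)) * ∫ θ in (-Real.pi)..Real.pi,
    (aT K1 K2 K3 * Real.cos ((n:ℝ)*θ) - bT K1 K2 K3 * Real.cos (((n:ℝ)-1)*θ)
      - cT K1 K2 * Real.cos (((n:ℝ)+1)*θ)) / Real.sqrt (RT K1 K2 K3 θ)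

/-- The integrand of the Toeplitz matrix element `wT`. -/
noncomputable def integrandT (a b c : ℝ) (n : ℤ) (θ : ℝ) : ℝ :=
  (a * Real.cos ((n:ℝ)*θ) - b * Real.cos (((n:ℝ)-1)*θ) - c * Real.cos (((n:ℝ)+1)*θ)) /
    Real.sqrt (a^2 + b^2 + c^2 - 2*a*(b + c)*Real.cos θ + 2*b*c*Real.cos (2*θ))

lemma wT_eq_integral_integrandT (K1 K2 K3 : ℝ) (n : ℤ) :
    wT K1 K2 K3 n = (1/(2*Real.pi)) * ∫ θ in (-Real.pi)..Real.pi,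
      integrandT (aT K1 K2 K3) (bT K1 K2 K3) (cT K1 K2) n θ := rfl

/-- A half-period shift of the integrand amounts to the sign change `a ↦ -a`. -/
lemma integrandT_add_pi (a b c : ℝ) (n : ℤ) (θ : ℝ) :
    integrandT a b c n (θ + Real.pi) = (-1:ℝ)^(n+1) * integrandT (-a) b c n θ := by
  have h (m : ℤ) : Real.cos ((m:ℝ)*(θ + Real.pi)) = (-1:ℝ)^m * Real.cos ((m:ℝ)*θ) := by
    rw [mul_add, Real.cos_add_int_mul_pi]
  have hm := h (n - 1)
  have hp := h (n + 1)
  rw [zpow_sub_one₀ (by norm_num)] at hm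
  rw [zpow_add_one₀ (by norm_num)] at hp
  push_cast at hm hp
  have h2 : Real.cos (2*(θ + Real.pi)) = Real.cos (2*θ) := by
    rw [mul_add, Real.cos_add_two_pi]
  unfold integrandT
  rw [h n, hm, hp, h2, Real.cos_add_pi, zpow_add_one₀ (by norm_num), ← mul_div_assoc]
  congr 1
  · norm_num
    ring
  · congr 1
    ring

lemma integrandT_periodic (a b c : ℝ) (n : ℤ) :
    Function.Periodic (integrandT a b c n) (2*Real.pi) := by
  intro θ
  rw [two_mul, ← add_assoc, integrandT_add_pi, integrandT_add_pi, neg_neg, ← mul_assoc,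
    ← mul_zpow]
  norm_num

lemma integral_integrandT_eq_neg (a b c : ℝ) (n : ℤ) :
    ∫ θ in (-Real.pi)..Real.pi, integrandT a b c n θ =
      (-1:ℝ)^(n+1) * ∫ θ in (-Real.pi)..Real.pi, integrandT (-a) b c n θ := by
  rw [← intervalIntegral.integral_const_mul]
  simp_rw [← integrandT_add_pi]
  rw [intervalIntegral.integral_comp_add_right]
  have h := (integrandT_periodic a b c n).intervalIntegral_add_eq (-Real.pi) (-Real.pi + Real.pi)
  rwa [show -Real.pi + 2*Real.pi = Real.pi by ring,
    show -Real.pi + Real.pi + 2*Real.pi = Real.pi + Real.pi by ring] at h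

lemma wT_eq_of_neg {K1 K2 K3 L1 L2 L3 : ℝ} (ha : aT L1 L2 L3 = -aT K1 K2 K3)
    (hb : bT L1 L2 L3 = bT K1 K2 K3) (hc : cT L1 L2 = cT K1 K2) (n : ℤ) :
    wT K1 K2 K3 n = (-1:ℝ)^(n+1) * wT L1 L2 L3 n := by
  rw [wT_eq_integral_integrandT, wT_eq_integral_integrandT, ha, hb, hc,
    integral_integrandT_eq_neg]
  ring

/-- Symmetries of the Toeplitz matrix elements of the triangular-lattice Ising model
under sign changes of the couplings. -/
theorem stmt5 (K1 K2 K3 : ℝ) (hR : ∀ θ : ℝ, 0 < RT K1 K2 K3 θ) :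
    ∀ n : ℤ,
      wT K1 K2 K3 n = wT (-K1) (-K2) K3 n ∧
      wT K1 K2 K3 n = (-1:ℝ)^(n+1) * wT (-K1) K2 (-K3) n ∧
      wT K1 K2 K3 n = (-1:ℝ)^(n+1) * wT K1 (-K2) (-K3) n := by
  intro n
  refine ⟨?_, wT_eq_of_neg ?_ ?_ ?_ n, wT_eq_of_neg ?_ ?_ ?_ n⟩
  · simp [wT, RT, aT, bT, cT, Real.tanh_neg]
  all_goals
    simp only [aT, bT, cT, Real.tanh_neg]
    ring
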